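/- Let Q be the 3-dimensional real Leibniz algebra with bracket determined by [g,e]=e and [g,f]=f (all other brackets of basis vectors zero). A linear map N : Q → Q is a Nijenhuis operator on Q if and only if its matrix (rows = coordinates of N(e), N(f), N(g) in the basis {e,f,g}) has one of the following forms for real parameters: (1) rows (k₁,k₂,0), (ℓ₁,ℓ₂,0), (0,0,p₃); (2) rows (k₁,k₂,0), (0,ℓ₂,0), (0,p₂,ℓ₂) with p₂≠0; (3) rows (k₁, p₂²ℓ₁/p₁² + p₂k₁/p₁ − p₂ℓ₂/p₁, 0), (ℓ₁,ℓ₂,0), (p₁, p₂, p₂ℓ₁/p₁ + k₁) with p₁≠0. -/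

import Mathlib

/-- Bracket of the 3-dim real Leibniz algebra with [g,e]=e, [g,f]=f
(basis e,f,g ↔ indices 0,1,2). -/
noncomputable def br (x y : Fin 3 → ℝ) : Fin 3 → ℝ :=
  ![x 2 * y 0, x 2 * y 1, 0]

/-- A linear endomorphism of `ℝ³` in terms of its values on the standard basis. -/
theorem map_eq_sum_basis (N : (Fin 3 → ℝ) →ₗ[ℝ] (Fin 3 → ℝ)) (y : Fin 3 → ℝ) :
    N y = y 0 • N ![1,0,0] + y 1 • N ![0,1,0] + y 2 • N ![0,0,1] := by
  rw [← map_smul, ← map_smul, ← map_smul, ← map_add, ← map_add]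
  congr 1
  ext i
  fin_cases i <;> simp

/-- `N` is a Nijenhuis operator iff it preserves the plane spanned by `e` and `f` and the
projection of `N g` to that plane is an eigenvector of `N` (or zero) with eigenvalue the
`g`-coordinate of `N g`. -/
theorem nijenhuis_iff_coordinates (N : (Fin 3 → ℝ) →ₗ[ℝ] (Fin 3 → ℝ)) {a b c : Fin 3 → ℝ}
    (ha : N ![1,0,0] = a) (hb : N ![0,1,0] = b) (hc : N ![0,0,1] = c) :
    (∀ x y, br (N x) (N y) + N (N (br x y)) = N (br (N x) y) + N (br x (N y))) ↔
      a 2 = 0 ∧ b 2 = 0 ∧ c 0 * a 0 + c 1 * b 0 = c 2 * c 0 ∧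
        c 0 * a 1 + c 1 * b 1 = c 2 * c 1 := by
  have hN : ∀ y, N y = y 0 • a + y 1 • b + y 2 • c := by
    intro y
    rw [map_eq_sum_basis N y, ha, hb, hc]
  simp only [hN, br]
  constructor
  · intro h
    have ha2 : a 2 = 0 := by
      have := congrFun (h ![1,0,0] ![1,0,0]) 2
      simpa using this
    have hb2 : b 2 = 0 := by
      have := congrFun (h ![0,1,0] ![0,1,0]) 2
      simpa using this
    have h0 := congrFun (h ![0,0,1] ![0,0,1]) 0
    have h1 := congrFun (h ![0,0,1] ![0,0,1]) 1
    simp at h0 h1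
    exact ⟨ha2, hb2, by linarith, by linarith⟩
  · rintro ⟨ha2, hb2, h0, h1⟩ x y
    ext i
    fin_cases i <;> simp [ha2, hb2]
    · linear_combination -(x 2 * y 2) * h0
    · linear_combination -(x 2 * y 2) * h1

theorem nijenhuis_classification_thm2_13 (N : (Fin 3 → ℝ) →ₗ[ℝ] (Fin 3 → ℝ)) :
    (∀ x y, br (N x) (N y) + N (N (br x y)) = N (br (N x) y) + N (br x (N y)))
    ↔
    ((∃ k₁ k₂ ℓ₁ ℓ₂ p₃ : ℝ,
        N ![1,0,0] = ![k₁,k₂,0] ∧ N ![0,1,0] = ![ℓ₁,ℓ₂,0] ∧ N ![0,0,1] = ![0,0,p₃]) ∨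
     (∃ k₁ k₂ ℓ₂ p₂ : ℝ, p₂ ≠ 0 ∧
        N ![1,0,0] = ![k₁,k₂,0] ∧ N ![0,1,0] = ![0,ℓ₂,0] ∧ N ![0,0,1] = ![0,p₂,ℓ₂]) ∨
     (∃ k₁ ℓ₁ ℓ₂ p₁ p₂ : ℝ, p₁ ≠ 0 ∧
        N ![1,0,0] = ![k₁, p₂^2*ℓ₁/p₁^2 + p₂*k₁/p₁ - p₂*ℓ₂/p₁, 0] ∧
        N ![0,1,0] = ![ℓ₁,ℓ₂,0] ∧
        N ![0,0,1] = ![p₁,p₂,p₂*ℓ₁/p₁ + k₁])) := by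
  constructor
  · intro h
    obtain ⟨ha2, hb2, h0, h1⟩ := (nijenhuis_iff_coordinates N rfl rfl rfl).1 h
    have vec_eq : ∀ v : Fin 3 → ℝ, v = ![v 0, v 1, v 2] := by
      intro v
      ext i
      fin_cases i <;> rfl
    have ha := vec_eq (N ![1,0,0])
    have hb := vec_eq (N ![0,1,0])
    have hc := vec_eq (N ![0,0,1])
    generalize N ![1,0,0] 0 = k₁, N ![1,0,0] 1 = k₂, N ![1,0,0] 2 = k₃,
      N ![0,1,0] 0 = ℓ₁, N ![0,1,0] 1 = ℓ₂, N ![0,1,0] 2 = ℓ₃,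
      N ![0,0,1] 0 = p₁, N ![0,0,1] 1 = p₂, N ![0,0,1] 2 = p₃ at *
    subst ha2 hb2
    by_cases hp₁ : p₁ = 0
    · subst hp₁
      by_cases hp₂ : p₂ = 0
      · subst hp₂
        exact Or.inl ⟨k₁, k₂, ℓ₁, ℓ₂, p₃, ha, hb, hc⟩
      · obtain rfl : ℓ₁ = 0 := by simpa [hp₂] using h0
        obtain rfl : ℓ₂ = p₃ := mul_left_cancel₀ hp₂ (by linarith)
        exact Or.inr (Or.inl ⟨k₁, k₂, ℓ₂, p₂, hp₂, ha, hb, hc⟩)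
    · have hp₃ : p₃ = p₂*ℓ₁/p₁ + k₁ := by
        field_simp
        linarith
      have hk₂ : k₂ = p₂^2*ℓ₁/p₁^2 + p₂*k₁/p₁ - p₂*ℓ₂/p₁ := by
        rw [hp₃] at h1
        field_simp at h1 ⊢
        linarith
      exact Or.inr (Or.inr ⟨k₁, ℓ₁, ℓ₂, p₁, p₂, hp₁, hk₂ ▸ ha, hb, hp₃ ▸ hc⟩)
  · rintro (⟨k₁, k₂, ℓ₁, ℓ₂, p₃, ha, hb, hc⟩ | ⟨k₁, k₂, ℓ₂, p₂, -, ha, hb, hc⟩ |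
      ⟨k₁, ℓ₁, ℓ₂, p₁, p₂, hp₁, ha, hb, hc⟩) <;>
      rw [nijenhuis_iff_coordinates N ha hb hc]
    · simp
    · simp [mul_comm]
    · refine ⟨rfl, rfl, ?_, ?_⟩ <;> simp <;> field_simp <;> ring
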